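/- There exists a universal constant c > 0 such that for every ε > 0, setting C_ε := c·‖η_ε‖_{L^{6/5}(ℝ³)}, the following holds: for all smooth compactly supported vector fields u, v : ℝ³ → ℝ³, |b(η_ε ∗ u, v, u)| ≤ C_ε ‖∇u‖_{L²} ‖u‖_{L²} ‖∇v‖_{L²}. -/

import Mathlib

open MeasureTheory Filter Topology

noncomputable section

/-- ℝ³ with the Euclidean norm. -/
abbrev V3 : Type := EuclideanSpace ℝ (Fin 3)

/-- The standard mollifier: `η(x) = C·exp(1/(|x|²−1))` for `|x| < 1`, `0` otherwise. -/
def eta (C : ℝ) (x : V3) : ℝ :=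
  if ‖x‖ < 1 then C * Real.exp (1 / (‖x‖ ^ 2 - 1)) else 0

/-- The rescaled mollifier `η_ε(x) = ε⁻³ η(x/ε)`. -/
def etaEps (C ε : ℝ) (x : V3) : ℝ := ε⁻¹ ^ 3 * eta C (ε⁻¹ • x)

/-- The mollification `k_ε f = η_ε ∗ f` of a scalar function `f`. -/
def mollify (C ε : ℝ) (f : V3 → ℝ) : V3 → ℝ :=
  convolution (etaEps C ε) f (ContinuousLinearMap.mul ℝ ℝ) volume

/-- `∂ v_j / ∂ x_i` at `x`. -/
def partialD (i j : Fin 3) (v : V3 → V3) (x : V3) : ℝ :=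
  fderiv ℝ v x (EuclideanSpace.single i 1) j

/-- The trilinear form `b(u,v,w) = ∑_{i,j} ∫ u_i ∂v_j/∂x_i w_j dx`. -/
def bform (u v w : V3 → V3) : ℝ :=
  ∑ i : Fin 3, ∑ j : Fin 3, ∫ x : V3, u x i * partialD i j v x * w x j

/-- The divergence `div u = ∑ i, ∂u_i/∂x_i`. -/
def divg (u : V3 → V3) (x : V3) : ℝ := ∑ i : Fin 3, partialD i i u x

/-- `i`-th component of the componentwise mollification `η_ε ∗ u` of a vector field. -/
def mollifyComp (C ε : ℝ) (u : V3 → V3) (i : Fin 3) : V3 → ℝ :=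
  mollify C ε (fun y => u y i)

/-- The trilinear form `b(η_ε ∗ u, v, w)` with mollified first argument. -/
def bMol (C ε : ℝ) (u v w : V3 → V3) : ℝ :=
  ∑ i : Fin 3, ∑ j : Fin 3, ∫ x : V3, mollifyComp C ε u i x * partialD i j v x * w x j

/-- The `L^p` norm (w.r.t. Lebesgue measure) of a scalar function. -/
def lpNorm (p : ℝ) (g : V3 → ℝ) : ℝ := (∫ x : V3, |g x| ^ p) ^ (1 / p)

/-- The `L^p` norm of a vector field (L^p norm of the pointwise Euclidean norm). -/
def vecLp (p : ℝ) (u : V3 → V3) : ℝ := lpNorm p (fun x => ‖u x‖)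

/-- Pointwise Euclidean norm of the mollified vector field `η_ε ∗ u`. -/
def molNorm (C ε : ℝ) (u : V3 → V3) (x : V3) : ℝ :=
  Real.sqrt (∑ i : Fin 3, (mollifyComp C ε u i x) ^ 2)

/-- `L^p` norm of the mollified vector field `η_ε ∗ u`. -/
def molLp (p C ε : ℝ) (u : V3 → V3) : ℝ := lpNorm p (molNorm C ε u)

/-- Pointwise Frobenius norm of the derivative matrix `(∂v_j/∂x_i)_{i,j}`. -/
def gradNorm (v : V3 → V3) (x : V3) : ℝ :=
  Real.sqrt (∑ i : Fin 3, ∑ j : Fin 3, (partialD i j v x) ^ 2)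

/-- `‖∇v‖_{L²}`, the `L²` norm of the pointwise Frobenius norm of the derivative. -/
def gradL2 (v : V3 → V3) : ℝ := lpNorm 2 (gradNorm v)

/-- The `H¹` norm `(‖f‖_{L²}² + ‖∇f‖_{L²}²)^{1/2}` of a vector field. -/
def h1Norm (u : V3 → V3) : ℝ := Real.sqrt ((vecLp 2 u) ^ 2 + (gradL2 u) ^ 2)

theorem lpNorm_nonneg (p : ℝ) (g : V3 → ℝ) : 0 ≤ _root_.lpNorm p g :=
  Real.rpow_nonneg (integral_nonneg fun _ => Real.rpow_nonneg (abs_nonneg _) _) _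

theorem ofReal_lpNorm_norm_eq_eLpNorm {E : Type*} [NormedAddCommGroup E] {p : ℝ} (hp : 0 < p)
    {f : V3 → E} (hf : MemLp f (ENNReal.ofReal p)) :
    ENNReal.ofReal (_root_.lpNorm p fun x => ‖f x‖) = eLpNorm f (ENNReal.ofReal p) volume := by
  rw [hf.eLpNorm_eq_integral_rpow_norm (by simpa using hp) ENNReal.ofReal_ne_top,
    ENNReal.toReal_ofReal hp.le]
  simp [_root_.lpNorm]

/-- Hölder's inequality. -/
theorem integral_abs_mul_le_lpNorm {p q : ℝ} (hpq : p.HolderConjugate q) {f g : V3 → ℝ}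
    (hf : MemLp f (ENNReal.ofReal p)) (hg : MemLp g (ENNReal.ofReal q)) :
    ∫ x, |f x| * |g x| ≤ _root_.lpNorm p f * _root_.lpNorm q g :=
  integral_mul_norm_le_Lp_mul_Lq hpq hf hg

theorem measurable_eta (C : ℝ) : Measurable (eta C) := by
  unfold eta
  exact Measurable.ite (measurableSet_lt measurable_norm measurable_const) (by fun_prop)
    measurable_const

theorem abs_eta_le {C : ℝ} (hC : 0 < C) (x : V3) : |eta C x| ≤ C := by
  unfold eta
  split_ifs with h
  · rw [abs_of_pos (by positivity)]
    refine mul_le_of_le_one_right hC.le (Real.exp_le_one_iff.2 ?_)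
    refine div_nonpos_of_nonneg_of_nonpos zero_le_one ?_
    nlinarith [norm_nonneg x]
  · simpa using hC.le

theorem memLp_etaEps {C ε : ℝ} (hC : 0 < C) (hε : 0 < ε) (p : ENNReal) :
    MemLp (etaEps C ε) p := by
  have hmeas : Measurable (etaEps C ε) :=
    measurable_const.mul ((measurable_eta C).comp (measurable_const_smul _))
  refine ((memLp_indicator_const p (measurableSet_ball (x := (0 : V3)) (ε := ε))
    (ε⁻¹ ^ 3 * C) (Or.inr measure_ball_lt_top.ne))).mono hmeas.aestronglyMeasurable
    (Eventually.of_forall fun x => ?_)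
  by_cases hx : x ∈ Metric.ball (0 : V3) ε
  · rw [Set.indicator_of_mem hx, etaEps, norm_mul, norm_mul]
    gcongr
    exact (abs_eta_le hC _).trans (le_abs_self C)
  · have : ¬ ‖ε⁻¹ • x‖ < 1 := by
      rw [norm_smul, Real.norm_of_nonneg (by positivity), inv_mul_lt_iff₀ hε, mul_one]
      simpa using hx
    simp [etaEps, eta, this]

theorem abs_apply_le_norm (x : V3) (i : Fin 3) : |x i| ≤ ‖x‖ :=
  PiLp.norm_apply_le x i

/-- Hölder's inequality for the mollification. -/
theorem abs_mollifyComp_le {C ε : ℝ} (hC : 0 < C) (hε : 0 < ε) {p q : ℝ}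
    (hpq : p.HolderConjugate q) {u : V3 → V3} (hu : Continuous u) (hcu : HasCompactSupport u)
    (i : Fin 3) (x : V3) :
    |mollifyComp C ε u i x| ≤ _root_.lpNorm p (etaEps C ε) * vecLp q u := by
  have hcont : Continuous fun y => ‖u (x - y)‖ := by fun_prop
  have hmem : MemLp (fun y => ‖u (x - y)‖) (ENNReal.ofReal q) :=
    hcont.memLp_of_hasCompactSupport
      (hcu.norm.comp_homeomorph (Homeomorph.subLeft x))
  have hshift : _root_.lpNorm q (fun y => ‖u (x - y)‖) = vecLp q u := by
    unfold vecLp _root_.lpNorm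
    rw [integral_sub_left_eq_self (fun y => |‖u y‖| ^ q) volume x]
  have hint : Integrable fun y => |etaEps C ε y| * ‖u (x - y)‖ :=
    haveI : ENNReal.HolderConjugate (ENNReal.ofReal p) (ENNReal.ofReal q) := hpq.ennrealOfReal
    MemLp.integrable_mul (p := ENNReal.ofReal p) (q := ENNReal.ofReal q)
      (memLp_etaEps hC hε _).abs hmem
  calc |mollifyComp C ε u i x|
      ≤ ∫ y, |etaEps C ε y| * ‖u (x - y)‖ := by
        rw [← Real.norm_eq_abs]
        refine norm_integral_le_of_norm_le hint (Eventually.of_forall fun y => ?_)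
        rw [ContinuousLinearMap.mul_apply', norm_mul]
        exact mul_le_mul_of_nonneg_left (abs_apply_le_norm _ i) (norm_nonneg _)
    _ ≤ _ := by
        rw [← hshift]
        simpa using integral_abs_mul_le_lpNorm hpq (memLp_etaEps hC hε _) hmem

theorem norm_fderiv_le_gradNorm (u : V3 → V3) (x : V3) : ‖fderiv ℝ u x‖ ≤ gradNorm u x := by
  refine ContinuousLinearMap.opNorm_le_bound _ (Real.sqrt_nonneg _) fun y => ?_
  have hy : fderiv ℝ u x y = ∑ i, y i • fderiv ℝ u x (EuclideanSpace.single i 1) := by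
    conv_lhs => rw [← (EuclideanSpace.basisFun (Fin 3) ℝ).sum_repr y]
    simp
  have hsq : ∀ i, ∑ j, partialD i j u x ^ 2 = ‖fderiv ℝ u x (EuclideanSpace.single i 1)‖ ^ 2 := by
    intro i
    simp [EuclideanSpace.real_norm_sq_eq, partialD]
  calc ‖fderiv ℝ u x y‖
      ≤ ∑ i, |y i| * ‖fderiv ℝ u x (EuclideanSpace.single i 1)‖ := by
        rw [hy]
        refine (norm_sum_le _ _).trans_eq ?_
        simp [norm_smul]
    _ ≤ √(∑ i, |y i| ^ 2) * √(∑ i, ‖fderiv ℝ u x (EuclideanSpace.single i 1)‖ ^ 2) :=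
        Real.sum_mul_le_sqrt_mul_sqrt _ _ _
    _ = gradNorm u x * ‖y‖ := by
        rw [mul_comm, gradNorm, EuclideanSpace.norm_eq]
        simp [hsq]

theorem abs_partialD_le_gradNorm (i j : Fin 3) (v : V3 → V3) (x : V3) :
    |partialD i j v x| ≤ gradNorm v x := by
  refine Real.abs_le_sqrt ?_
  calc partialD i j v x ^ 2 ≤ ∑ j, partialD i j v x ^ 2 :=
        Finset.single_le_sum (f := fun j => partialD i j v x ^ 2)
          (fun _ _ => sq_nonneg _) (Finset.mem_univ j)
    _ ≤ _ := Finset.single_le_sum (f := fun i => ∑ j, partialD i j v x ^ 2)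
          (fun _ _ => Finset.sum_nonneg fun _ _ => sq_nonneg _) (Finset.mem_univ i)

theorem memLp_gradNorm {v : V3 → V3} (hv : ContDiff ℝ 1 v) (hcv : HasCompactSupport v)
    (p : ENNReal) : MemLp (gradNorm v) p := by
  have hfd := hv.continuous_fderiv one_ne_zero
  refine Continuous.memLp_of_hasCompactSupport (by unfold gradNorm partialD; fun_prop)
    ((hcv.fderiv ℝ).mono fun x hx => ?_)
  contrapose! hx
  have : fderiv ℝ v x = 0 := by simpa using hx
  simp [gradNorm, partialD, this]

/-- The Sobolev inequality `‖u‖_{L⁶} ≤ K ‖∇u‖_{L²}` on `ℝ³`. -/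
theorem exists_vecLp_six_le_gradL2 : ∃ K : ℝ, 0 ≤ K ∧ ∀ u : V3 → V3,
    ContDiff ℝ 1 u → HasCompactSupport u → vecLp 6 u ≤ K * gradL2 u := by
  refine ⟨eLpNormLESNormFDerivOfEqInnerConst (volume : Measure V3) 2, NNReal.coe_nonneg _,
    fun u hu hcu => ?_⟩
  have key := eLpNorm_le_eLpNorm_fderiv_of_eq_inner (volume : Measure V3) hu hcu
    (p := 2) (p' := 6) one_le_two (by simp) (by simp; norm_num)
  have h6 := ofReal_lpNorm_norm_eq_eLpNorm (p := 6) (by norm_num)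
    (hu.continuous.memLp_of_hasCompactSupport hcu)
  have h2 := ofReal_lpNorm_norm_eq_eLpNorm (p := 2) (by norm_num) (memLp_gradNorm hu hcu _)
  have hmono : eLpNorm (fderiv ℝ u) 2 volume ≤ eLpNorm (gradNorm u) 2 volume :=
    eLpNorm_mono fun x => (norm_fderiv_le_gradNorm u x).trans (le_abs_self _)
  have hgrad : _root_.lpNorm 2 (fun x => ‖gradNorm u x‖) = gradL2 u := by
    simp [gradL2, _root_.lpNorm]
  rw [hgrad] at h2
  simp only [ENNReal.ofReal_ofNat] at h2 h6
  have h : ENNReal.ofReal (vecLp 6 u) ≤ ENNReal.ofReal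
      (eLpNormLESNormFDerivOfEqInnerConst (volume : Measure V3) 2 * gradL2 u) := by
    rw [ENNReal.ofReal_mul (NNReal.coe_nonneg _), ENNReal.ofReal_coe_nnreal, h2, vecLp, h6]
    exact key.trans (mul_le_mul_right hmono _)
  exact (ENNReal.ofReal_le_ofReal_iff
    (mul_nonneg (NNReal.coe_nonneg _) (lpNorm_nonneg _ _))).1 h

/-- If `|η_ε ∗ u| ≤ M` componentwise then `|b(η_ε ∗ u, v, w)| ≤ 9 M ‖∇v‖_{L²} ‖w‖_{L²}`. -/
theorem abs_bMol_le {C ε M : ℝ} {u v w : V3 → V3} (hM : ∀ i x, |mollifyComp C ε u i x| ≤ M)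
    (hv : ContDiff ℝ 1 v) (hcv : HasCompactSupport v)
    (hw : Continuous w) (hcw : HasCompactSupport w) :
    |bMol C ε u v w| ≤ 9 * (M * (gradL2 v * vecLp 2 w)) := by
  have hM0 : 0 ≤ M := (abs_nonneg _).trans (hM 0 0)
  have hgv : MemLp (gradNorm v) (ENNReal.ofReal 2) := memLp_gradNorm hv hcv _
  have hw2 : MemLp (fun x => ‖w x‖) (ENNReal.ofReal 2) :=
    hw.norm.memLp_of_hasCompactSupport hcw.norm
  have hint : Integrable fun x => gradNorm v x * ‖w x‖ :=
    haveI := Real.HolderConjugate.two_two.ennrealOfReal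
    MemLp.integrable_mul hgv hw2
  have hterm : ∀ i j, |∫ x, mollifyComp C ε u i x * partialD i j v x * w x j|
      ≤ M * (gradL2 v * vecLp 2 w) := by
    intro i j
    calc |∫ x, mollifyComp C ε u i x * partialD i j v x * w x j|
        ≤ ∫ x, M * (gradNorm v x * ‖w x‖) := by
          rw [← Real.norm_eq_abs]
          refine norm_integral_le_of_norm_le (hint.const_mul M) (Eventually.of_forall fun x => ?_)
          rw [norm_mul, norm_mul, mul_assoc]
          gcongr
          · exact hM i x
          · exact Real.sqrt_nonneg _
          · exact abs_partialD_le_gradNorm i j v x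
          · exact abs_apply_le_norm _ j
      _ ≤ _ := by
          rw [integral_const_mul]
          gcongr
          refine le_of_eq_of_le ?_
            (integral_abs_mul_le_lpNorm Real.HolderConjugate.two_two hgv hw2)
          simp [gradNorm, abs_of_nonneg (Real.sqrt_nonneg _)]
  calc |bMol C ε u v w|
      ≤ ∑ _i : Fin 3, ∑ _j : Fin 3, M * (gradL2 v * vecLp 2 w) :=
        (Finset.abs_sum_le_sum_abs _ _).trans <| Finset.sum_le_sum fun i _ =>
          (Finset.abs_sum_le_sum_abs _ _).trans <| Finset.sum_le_sum fun j _ => hterm i j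
    _ = _ := by simp; ring

/-- there is a universal constant `c > 0` such that for every `ε > 0`, with
`C_ε = c·‖η_ε‖_{L^{6/5}}`, for all smooth compactly supported vector fields `u, v`:
`|b(η_ε ∗ u, v, u)| ≤ C_ε ‖∇u‖_{L²} ‖u‖_{L²} ‖∇v‖_{L²}`. -/
theorem stmt9 (C : ℝ) (hC : 0 < C) (hnorm : ∫ x : V3, eta C x = 1) :
    ∃ c : ℝ, 0 < c ∧ ∀ ε : ℝ, 0 < ε → ∀ u v : V3 → V3,
      ContDiff ℝ (⊤ : ℕ∞) u → HasCompactSupport u →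
      ContDiff ℝ (⊤ : ℕ∞) v → HasCompactSupport v →
      |bMol C ε u v u| ≤ (c * lpNorm (6 / 5) (etaEps C ε)) *
        (gradL2 u * vecLp 2 u * gradL2 v) := by
  obtain ⟨K, hK, hsob⟩ := exists_vecLp_six_le_gradL2
  refine ⟨9 * (K + 1), by positivity, fun ε hε u v hu hcu hv hcv => ?_⟩
  have hu1 : ContDiff ℝ 1 u := hu.of_le (by exact_mod_cast le_top)
  have hv1 : ContDiff ℝ 1 v := hv.of_le (by exact_mod_cast le_top)
  have hpq : (6 / 5 : ℝ).HolderConjugate 6 :=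
    Real.holderConjugate_iff.2 ⟨by norm_num, by norm_num⟩
  have hη := lpNorm_nonneg (6 / 5) (etaEps C ε)
  have hgu : 0 ≤ gradL2 u := lpNorm_nonneg _ _
  have hgv : 0 ≤ gradL2 v := lpNorm_nonneg _ _
  have hu2 : 0 ≤ vecLp 2 u := lpNorm_nonneg _ _
  calc |bMol C ε u v u|
      ≤ 9 * (_root_.lpNorm (6 / 5) (etaEps C ε) * vecLp 6 u * (gradL2 v * vecLp 2 u)) :=
        abs_bMol_le (fun i x => abs_mollifyComp_le hC hε hpq hu.continuous hcu i x)
          hv1 hcv hu.continuous hcu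
    _ ≤ 9 * (_root_.lpNorm (6 / 5) (etaEps C ε) * ((K + 1) * gradL2 u) *
          (gradL2 v * vecLp 2 u)) := by
        gcongr
        exact (hsob u hu1 hcu).trans (by gcongr; linarith)
    _ = _ := by ring
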